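/- Let A* be an (r−1)-connected (r > 1) Poincaré DGCA of degree n and l ≥ 3. Then: (1) if n ≤ r(l+1) + (1−l), the l'-th order Massey product of every Massey l'-tuple is trivial for every l' ≥ l; (2) if n = r(l+1) + (2−l) + q with q ≥ 0, then the l-th order Massey product of every Massey l-tuple whose degree does not lie in {(r+a_1,…,r+a_l) : a_i ≥ 0, 0 ≤ Σ_{i=1}^l a_i ≤ q} is trivial. -/

import Mathlib

universe u v

open scoped TensorProduct

/-- A (not necessarily commutative) differential graded algebra over `F`:
a nonnegatively graded, associative, unital `F`-algebra equipped with a degree `+1`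
differential `d` satisfying `d ∘ d = 0` and the graded Leibniz rule. -/
structure DGA (F : Type u) (A : Type v) [Field F] [Ring A] [Algebra F A] where
  grading : ℤ → Submodule F A
  internal : DirectSum.IsInternal grading
  nonneg : ∀ i : ℤ, i < 0 → grading i = ⊥
  one_mem : (1 : A) ∈ grading 0
  mul_mem : ∀ {i j : ℤ} {a b : A}, a ∈ grading i → b ∈ grading j → a * b ∈ grading (i + j)
  d : A →ₗ[F] A
  d_mem : ∀ {i : ℤ} {a : A}, a ∈ grading i → d a ∈ grading (i + 1)
  d_d : ∀ a : A, d (d a) = 0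
  leibniz : ∀ {i : ℤ} (a b : A), a ∈ grading i →
    d (a * b) = d a * b + ((-1 : F) ^ i) • (a * d b)

namespace DGA

variable {F : Type u} {A : Type v} [Field F] [Ring A] [Algebra F A]

/-- The cocycles of degree `k`. -/
def Zc (D : DGA F A) (k : ℤ) : Submodule F A := D.grading k ⊓ LinearMap.ker D.d

/-- The coboundaries of degree `k`. -/
def Bc (D : DGA F A) (k : ℤ) : Submodule F A := Submodule.map D.d (D.grading (k - 1))

/-- `a` is exact, i.e. a coboundary. -/
def IsExact (D : DGA F A) (a : A) : Prop := ∃ b, a = D.d b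

/-- Two elements define the same cohomology class. -/
def Cohomologous (D : DGA F A) (a b : A) : Prop := ∃ c, a - b = D.d c

/-- `H^0 = F·[1]`. -/
def Connected (D : DGA F A) : Prop :=
  ∀ a ∈ D.grading 0, D.d a = 0 → ∃ c : F, a = c • (1 : A)

/-- Connected and `H^k = 0` for `1 ≤ k ≤ r`.  An `(r-1)`-connected DGA in the sense of
the paper is one satisfying `RConnected (r-1)`. -/
def RConnected (D : DGA F A) (r : ℤ) : Prop :=
  D.Connected ∧ ∀ k : ℤ, 1 ≤ k → k ≤ r → ∀ a ∈ D.grading k, D.d a = 0 → D.IsExact a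

/-- A harmonic subspace: a graded complement of the coboundaries inside the cocycles. -/
def IsHarmonicFamily (D : DGA F A) (H : ℤ → Submodule F A) : Prop :=
  ∀ k : ℤ, H k ≤ D.Zc k ∧ Disjoint (D.Bc k) (H k) ∧ D.Zc k ≤ D.Bc k ⊔ H k

/-- The operator `d⁻` attached to a decomposition `A = dA ⊕ H ⊕ B`: the inverse of
`d : B → dA` extended by `0` on `H ⊕ B`. -/
def IsDminus (D : DGA F A) (H B : ℤ → Submodule F A) (dm : A →ₗ[F] A) : Prop :=
  (∀ k : ℤ, ∀ b ∈ B k, dm (D.d b) = b) ∧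
  (∀ k : ℤ, ∀ h ∈ H k, dm h = 0) ∧
  (∀ k : ℤ, ∀ b ∈ B k, dm b = 0) ∧
  (∀ k : ℤ, ∀ a ∈ D.grading k, dm a ∈ B (k - 1))

/-- The projection `π_H : A → H` with kernel `dA ⊕ B`. -/
def IsHarmonicProj (D : DGA F A) (H B : ℤ → Submodule F A) (pH : A →ₗ[F] A) : Prop :=
  (∀ k : ℤ, ∀ h ∈ H k, pH h = h) ∧
  (∀ k : ℤ, ∀ b ∈ B k, pH b = 0) ∧
  (∀ a : A, pH (D.d a) = 0) ∧
  (∀ k : ℤ, ∀ a ∈ D.grading k, pH a ∈ H k)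

/-- The degree of the entry `a i j` of a defining system: `|x_i| + ⋯ + |x_j| - (j - i)`. -/
def degSum (deg : ℕ → ℤ) (i j : ℕ) : ℤ :=
  (∑ t ∈ Finset.Icc i j, deg t) - ((j - i : ℕ) : ℤ)

/-- A defining system for the `l`-th order Massey product of the classes of the
cocycles `x 1, …, x l` (of degrees `deg 1, …, deg l`). -/
def IsDefiningSystem (D : DGA F A) (l : ℕ) (deg : ℕ → ℤ) (x : ℕ → A)
    (a : ℕ → ℕ → A) : Prop :=
  (∀ i : ℕ, 1 ≤ i → i ≤ l →
      a i i ∈ D.grading (deg i) ∧ D.d (a i i) = 0 ∧ D.Cohomologous (a i i) (x i)) ∧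
  (∀ i j : ℕ, 1 ≤ i → i ≤ j → j ≤ l → a i j ∈ D.grading (degSum deg i j)) ∧
  (∀ i j : ℕ, 1 ≤ i → i < j → j ≤ l → ¬(i = 1 ∧ j = l) →
    D.d (a i j) = ∑ k ∈ Finset.Ico i j, ((-1 : F) ^ degSum deg i k) • (a i k * a (k + 1) j))

/-- The cocycle `∑ ā_{1k} a_{k+1,l}` produced by a defining system. -/
def masseyOut (D : DGA F A) (l : ℕ) (deg : ℕ → ℤ) (a : ℕ → ℕ → A) : A :=
  ∑ k ∈ Finset.Ico 1 l, ((-1 : F) ^ degSum deg 1 k) • (a 1 k * a (k + 1) l)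

/-- `(x 1, …, x l)` is a Massey `l`-tuple: the Massey product is nonempty. -/
def IsMasseyTuple (D : DGA F A) (l : ℕ) (deg : ℕ → ℤ) (x : ℕ → A) : Prop :=
  (∀ i : ℕ, 1 ≤ i → i ≤ l → x i ∈ D.Zc (deg i)) ∧ ∃ a, D.IsDefiningSystem l deg x a

/-- The `l`-th order Massey product of `(x 1, …, x l)` is trivial: it contains `0`. -/
def MasseyTrivial (D : DGA F A) (l : ℕ) (deg : ℕ → ℤ) (x : ℕ → A) : Prop :=
  ∃ a, D.IsDefiningSystem l deg x a ∧ D.IsExact (D.masseyOut l deg a)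

end DGA

/-- A differential graded commutative algebra (DGCA) over `F`. -/
structure DGCA (F : Type u) (A : Type v) [Field F] [Ring A] [Algebra F A]
    extends DGA F A where
  gcomm : ∀ {i j : ℤ} (a b : A), a ∈ grading i → b ∈ grading j →
    a * b = ((-1 : F) ^ (i * j)) • (b * a)

/-- A Poincaré DGCA of degree `n`: a DGCA concentrated in degrees `0, …, n`, with finite
dimensional cohomology, equipped with a linear functional `∫` (given here as `intg`, a
functional on `A` vanishing in degrees `≠ n` and on coboundaries) such that the induced
pairing `⟨a, b⟩ = ∫ [a * b]` is nondegenerate on cohomology. -/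
structure PoincareDGCA (F : Type u) (A : Type v) [Field F] [Ring A] [Algebra F A]
    (n : ℤ) extends DGCA F A where
  top : ∀ i : ℤ, n < i → grading i = ⊥
  fin_cohomology : ∀ k : ℤ, ∃ W : Submodule F A, FiniteDimensional F W ∧
    ∀ a ∈ grading k, d a = 0 → ∃ w ∈ W, ∃ c, a - w = d c
  intg : A →ₗ[F] F
  intg_deg : ∀ i : ℤ, i ≠ n → ∀ a ∈ grading i, intg a = 0
  intg_d : ∀ a : A, intg (d a) = 0
  nondeg : ∀ i : ℤ, ∀ a ∈ grading i, d a = 0 →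
    (∀ b ∈ grading (n - i), d b = 0 → intg (a * b) = 0) → ∃ c, a = d c

namespace PoincareDGCA

variable {F : Type u} {A : Type v} [Field F] [Ring A] [Algebra F A] {n : ℤ}

/-- The null space `A⊥` of the induced pairing `⟨a, b⟩ = ∫ (a * b)` on `A`. -/
def perp (P : PoincareDGCA F A n) : Submodule F A :=
  ⨅ b : A, LinearMap.ker (P.intg ∘ₗ LinearMap.mulRight F b)

/-- `A = dA ⊕ H ⊕ B` is a Hodge type decomposition: `H` is a harmonic subspace,
`B` is a graded complement, and `⟨H ⊕ B, B⟩ = 0`. -/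
def IsHodge (P : PoincareDGCA F A n) (H B : ℤ → Submodule F A) : Prop :=
  P.toDGA.IsHarmonicFamily H ∧
  (∀ k : ℤ, B k ≤ P.grading k) ∧
  (∀ k : ℤ, Disjoint (P.toDGA.Bc k ⊔ H k) (B k)) ∧
  (∀ k : ℤ, P.grading k ≤ P.toDGA.Bc k ⊔ H k ⊔ B k) ∧
  (∀ j k : ℤ, ∀ a ∈ H j ⊔ B j, ∀ b ∈ B k, P.intg (a * b) = 0)

/-- A Poincaré DGCA of Hodge type: one admitting a Hodge type decomposition. -/
def HodgeType (P : PoincareDGCA F A n) : Prop := ∃ H B, P.IsHodge H B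

end PoincareDGCA

/-- A bundled DGCA over `F`. -/
structure BDGCA (F : Type u) [Field F] : Type (max (u + 1) (v + 1)) where
  carrier : Type v
  [ringInst : Ring carrier]
  [algInst : Algebra F carrier]
  str : DGCA F carrier

attribute [instance] BDGCA.ringInst BDGCA.algInst

/-- A morphism of DGCAs: an algebra homomorphism preserving the grading and
commuting with the differentials. -/
structure DGCAHom {F : Type u} [Field F] (X Y : BDGCA.{u, v} F) where
  f : X.carrier →ₐ[F] Y.carrier
  map_grading : ∀ i : ℤ, ∀ a ∈ X.str.grading i, f a ∈ Y.str.grading i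
  map_d : ∀ a, f (X.str.d a) = Y.str.d (f a)

/-- A quasi-isomorphism: a DGCA morphism inducing an isomorphism on cohomology. -/
def DGCAHom.QuasiIso {F : Type u} [Field F] {X Y : BDGCA.{u, v} F}
    (φ : DGCAHom X Y) : Prop :=
  (∀ i : ℤ, ∀ a ∈ X.str.grading i, X.str.d a = 0 →
    (∃ b, φ.f a = Y.str.d b) → ∃ c, a = X.str.d c) ∧
  (∀ i : ℤ, ∀ a' ∈ Y.str.grading i, Y.str.d a' = 0 →
    ∃ a ∈ X.str.grading i, X.str.d a = 0 ∧ ∃ b, φ.f a - a' = Y.str.d b)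

/-- Two DGCAs are equivalent if they are joined by a finite zig-zag of
quasi-isomorphisms. -/
def DGCAEquivalent {F : Type u} [Field F] : BDGCA.{u, v} F → BDGCA.{u, v} F → Prop :=
  Relation.EqvGen fun X Y => ∃ φ : DGCAHom X Y, φ.QuasiIso

/-- A DGCA is formal if it is equivalent to a DGCA with zero differential
(equivalently, to its cohomology with the zero differential). -/
def DGCAFormal {F : Type u} [Field F] (X : BDGCA.{u, v} F) : Prop :=
  ∃ Y : BDGCA.{u, v} F, Y.str.d = 0 ∧ DGCAEquivalent X Y

namespace DGA

theorem degSum_add (deg : ℕ → ℤ) {i k j : ℕ} (hik : i ≤ k) (hkj : k < j) :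
    degSum deg i k + degSum deg (k + 1) j = degSum deg i j + 1 := by
  have h := Finset.sum_Ico_consecutive deg (show i ≤ k + 1 by lia) (show k + 1 ≤ j + 1 by lia)
  simp only [Finset.Ico_add_one_right_eq_Icc] at h
  unfold degSum
  rw [← h]
  push_cast [Nat.cast_sub, hik, show k + 1 ≤ j by lia, show i ≤ j by lia]
  ring

theorem degSum_self (deg : ℕ → ℤ) (i : ℕ) : degSum deg i i = deg i := by
  simp [degSum]

variable {F : Type u} {A : Type v} [Field F] [Ring A] [Algebra F A]

theorem masseyOut_mem (D : DGA F A) {l : ℕ} {deg : ℕ → ℤ} {x : ℕ → A} {a : ℕ → ℕ → A}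
    (ha : D.IsDefiningSystem l deg x a) :
    D.masseyOut l deg a ∈ D.grading (degSum deg 1 l + 1) := by
  refine Submodule.sum_mem _ fun k hk => Submodule.smul_mem _ _ ?_
  rw [Finset.mem_Ico] at hk
  rw [← degSum_add deg hk.1 hk.2]
  exact D.mul_mem (ha.2.1 1 k le_rfl hk.1 hk.2.le) (ha.2.1 (k + 1) l (by lia) hk.2 le_rfl)

theorem d_defining (D : DGA F A) {l : ℕ} {deg : ℕ → ℤ} {x : ℕ → A} {a : ℕ → ℕ → A}
    (ha : D.IsDefiningSystem l deg x a) {i j : ℕ} (hi : 1 ≤ i) (hij : i ≤ j) (hj : j ≤ l)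
    (h : ¬(i = 1 ∧ j = l)) :
    D.d (a i j) = ∑ k ∈ Finset.Ico i j, ((-1 : F) ^ degSum deg i k) • (a i k * a (k + 1) j) := by
  rcases hij.eq_or_lt with rfl | hlt
  · simpa using (ha.1 i hi hj).2.1
  · exact ha.2.2 i j hi hlt hj h

theorem d_masseyOut (D : DGA F A) {l : ℕ} {deg : ℕ → ℤ} {x : ℕ → A} {a : ℕ → ℕ → A}
    (ha : D.IsDefiningSystem l deg x a) : D.d (D.masseyOut l deg a) = 0 := by
  have h1 : D.d (D.masseyOut l deg a) =
      ∑ k ∈ Finset.Ico 1 l, ((∑ m ∈ Finset.Ico 1 k, ((-1 : F) ^ degSum deg 1 k *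
          (-1 : F) ^ degSum deg 1 m) • (a 1 m * a (m + 1) k * a (k + 1) l)) +
        ∑ m ∈ Finset.Ico (k + 1) l, ((-1 : F) ^ degSum deg (k + 1) m) •
          (a 1 k * a (k + 1) m * a (m + 1) l)) := by
    rw [masseyOut, map_sum]
    refine Finset.sum_congr rfl fun k hk => ?_
    rw [Finset.mem_Ico] at hk
    rw [map_smul, D.leibniz _ _ (ha.2.1 1 k le_rfl hk.1 hk.2.le),
      D.d_defining ha le_rfl hk.1 hk.2.le (by lia),
      D.d_defining ha (show 1 ≤ k + 1 by lia) hk.2 le_rfl (by lia), smul_add, smul_smul,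
      ← mul_zpow, neg_one_mul, neg_neg, one_zpow, one_smul, Finset.sum_mul, Finset.mul_sum,
      Finset.smul_sum]
    congr 1
    · exact Finset.sum_congr rfl fun m _ => by rw [smul_mul_assoc, smul_smul]
    · exact Finset.sum_congr rfl fun m _ => by rw [mul_smul_comm, mul_assoc]
  have h2 : ∑ k ∈ Finset.Ico 1 l, ∑ m ∈ Finset.Ico (k + 1) l, ((-1 : F) ^ degSum deg (k + 1) m) •
        (a 1 k * a (k + 1) m * a (m + 1) l) =
      ∑ m ∈ Finset.Ico 1 l, ∑ k ∈ Finset.Ico 1 m, ((-1 : F) ^ degSum deg (k + 1) m) •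
        (a 1 k * a (k + 1) m * a (m + 1) l) :=
    Finset.sum_comm' fun k m => by simp only [Finset.mem_Ico]; lia
  rw [h1, Finset.sum_add_distrib, h2, ← Finset.sum_add_distrib]
  refine Finset.sum_eq_zero fun k hk => ?_
  rw [← Finset.sum_add_distrib]
  refine Finset.sum_eq_zero fun m hm => ?_
  rw [Finset.mem_Ico] at hk hm
  have hne : (-1 : F) ≠ 0 := by simp
  have hs : degSum deg 1 k = degSum deg 1 m + degSum deg (m + 1) k - 1 := by
    rw [degSum_add deg hm.1 hm.2]; ring
  have hsq : (-1 : F) ^ degSum deg 1 m * (-1 : F) ^ degSum deg 1 m = 1 := by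
    rw [← mul_zpow]; simp
  rw [← add_smul, hs, zpow_sub₀ hne, zpow_add₀ hne, zpow_one]
  have : (-1 : F) ^ degSum deg 1 m * (-1 : F) ^ degSum deg (m + 1) k / -1 *
      (-1 : F) ^ degSum deg 1 m + (-1 : F) ^ degSum deg (m + 1) k = 0 := by
    linear_combination -(-1 : F) ^ degSum deg (m + 1) k * hsq
  rw [this, zero_smul]

/-- A Massey product with a vanishing entry is trivial. -/
theorem masseyTrivial_of_exact (D : DGA F A) {l : ℕ} {deg : ℕ → ℤ} {x : ℕ → A}
    {a : ℕ → ℕ → A} (ha : D.IsDefiningSystem l deg x a) {p : ℕ} (hp : 1 ≤ p) (hpl : p ≤ l)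
    (hex : D.IsExact (a p p)) : D.MasseyTrivial l deg x := by
  have hz : ∀ s : ℕ → F, ∀ i j, i ≤ p → p ≤ j → ∑ k ∈ Finset.Ico i j, s k •
      ((if i ≤ p ∧ p ≤ k then 0 else a i k) *
        (if k + 1 ≤ p ∧ p ≤ j then 0 else a (k + 1) j)) = 0 := by
    intro s i j hi hj
    refine Finset.sum_eq_zero fun k _ => ?_
    by_cases h : p ≤ k
    · rw [if_pos ⟨hi, h⟩, zero_mul, smul_zero]
    · rw [if_pos (show k + 1 ≤ p ∧ p ≤ j by lia), mul_zero, smul_zero]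
  refine ⟨fun i j => if i ≤ p ∧ p ≤ j then 0 else a i j, ⟨?_, ?_, ?_⟩, 0, ?_⟩
  · intro i hi hil
    dsimp only
    split_ifs with h
    · obtain rfl : i = p := by lia
      obtain ⟨b, hb⟩ := hex
      obtain ⟨c, hc⟩ := (ha.1 i hi hil).2.2
      refine ⟨Submodule.zero_mem _, map_zero _, c - b, ?_⟩
      rw [map_sub, ← hc, ← hb]
      abel
    · exact ha.1 i hi hil
  · intro i j hi hij hj
    dsimp only
    split_ifs
    · exact Submodule.zero_mem _
    · exact ha.2.1 i j hi hij hj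
  · intro i j hi hij hj hne
    dsimp only
    by_cases h : i ≤ p ∧ p ≤ j
    · rw [if_pos h, hz _ i j h.1 h.2, map_zero]
    · rw [if_neg h, ha.2.2 i j hi hij hj hne]
      refine Finset.sum_congr rfl fun k hk => ?_
      rw [Finset.mem_Ico] at hk
      rw [if_neg (by lia), if_neg (by lia)]
  · rw [map_zero]
    exact hz _ 1 l hp hpl

/-- In an `(r - 1)`-connected DGA, a Massey product with an entry of degree `< r` is trivial. -/
theorem masseyTrivial_of_deg_lt (D : DGA F A) {r : ℤ} (hconn : D.RConnected (r - 1))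
    {l : ℕ} (hl : 3 ≤ l) {deg : ℕ → ℤ} {x : ℕ → A}
    {a : ℕ → ℕ → A} (ha : D.IsDefiningSystem l deg x a) {p : ℕ} (hp : 1 ≤ p) (hpl : p ≤ l)
    (hdeg : deg p < r) : D.MasseyTrivial l deg x := by
  obtain ⟨hmem, hd, -⟩ := ha.1 p hp hpl
  rcases lt_trichotomy (deg p) 0 with h | h | h
  · rw [D.nonneg _ h, Submodule.mem_bot] at hmem
    exact D.masseyTrivial_of_exact ha hp hpl ⟨0, by rw [hmem, map_zero]⟩
  · rw [h] at hmem
    obtain ⟨c, hc⟩ := hconn.1 _ hmem hd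
    by_cases hc0 : c = 0
    · exact D.masseyTrivial_of_exact ha hp hpl ⟨0, by rw [hc, hc0, zero_smul, map_zero]⟩
    have hne : (-1 : F) ≠ 0 := by simp
    rcases hpl.eq_or_lt with hpl' | hlt
    · obtain ⟨m, rfl⟩ : ∃ m, p = m + 1 := ⟨p - 1, by lia⟩
      have e := ha.2.2 m (m + 1) (by lia) (by lia) hpl (by lia)
      rw [Nat.Ico_succ_singleton, Finset.sum_singleton, hc, mul_smul_comm, mul_one, smul_smul] at e
      have hu : (-1 : F) ^ degSum deg m m * c ≠ 0 := mul_ne_zero (zpow_ne_zero _ hne) hc0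
      refine D.masseyTrivial_of_exact ha (p := m) (by lia) (by lia)
        ⟨((-1 : F) ^ degSum deg m m * c)⁻¹ • a m (m + 1), ?_⟩
      rw [map_smul, e, inv_smul_smul₀ hu]
    · have e := ha.2.2 p (p + 1) hp (by lia) hlt (by lia)
      rw [Nat.Ico_succ_singleton, Finset.sum_singleton, hc, smul_mul_assoc, one_mul, smul_smul] at e
      have hu : (-1 : F) ^ degSum deg p p * c ≠ 0 := mul_ne_zero (zpow_ne_zero _ hne) hc0
      refine D.masseyTrivial_of_exact ha (p := p + 1) (by lia) hlt
        ⟨((-1 : F) ^ degSum deg p p * c)⁻¹ • a p (p + 1), ?_⟩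
      rw [map_smul, e, inv_smul_smul₀ hu]
  · exact D.masseyTrivial_of_exact ha hp hpl (hconn.2 _ (by lia) (by lia) _ hmem hd)

/-- Adding a cocycle to the entry `a 2 l` of a defining system. -/
theorem exists_defining_add (D : DGA F A) {l : ℕ} (hl : 3 ≤ l) {deg : ℕ → ℤ} {x : ℕ → A}
    {a : ℕ → ℕ → A} (ha : D.IsDefiningSystem l deg x a) {z : A}
    (hz : z ∈ D.grading (degSum deg 2 l)) (hdz : D.d z = 0) :
    ∃ a', D.IsDefiningSystem l deg x a' ∧
      D.masseyOut l deg a' = D.masseyOut l deg a + ((-1 : F) ^ deg 1) • (a 1 1 * z) := by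
  refine ⟨fun i j => if i = 2 ∧ j = l then a i j + z else a i j, ⟨?_, ?_, ?_⟩, ?_⟩
  · intro i hi hil
    dsimp only
    rw [if_neg (by lia)]
    exact ha.1 i hi hil
  · intro i j hi hij hj
    dsimp only
    split_ifs with h
    · obtain ⟨rfl, rfl⟩ := h
      exact Submodule.add_mem _ (ha.2.1 _ _ hi hij hj) hz
    · exact ha.2.1 i j hi hij hj
  · intro i j hi hij hj hne
    have e : D.d (if i = 2 ∧ j = l then a i j + z else a i j) = D.d (a i j) := by
      split_ifs
      · rw [map_add, hdz, add_zero]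
      · rfl
    dsimp only
    rw [e, ha.2.2 i j hi hij hj hne]
    refine Finset.sum_congr rfl fun k hk => ?_
    rw [Finset.mem_Ico] at hk
    rw [if_neg (by lia), if_neg (by lia)]
  · unfold masseyOut
    rw [Finset.sum_eq_sum_Ico_succ_bot (show 1 < l by lia),
      Finset.sum_eq_sum_Ico_succ_bot (show 1 < l by lia)]
    dsimp only
    rw [if_neg (show ¬(1 = 2 ∧ 1 = l) by lia), if_pos (show 1 + 1 = 2 ∧ l = l by lia),
      degSum_self, mul_add, smul_add, add_right_comm]
    congr 2
    refine Finset.sum_congr rfl fun k hk => ?_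
    rw [Finset.mem_Ico] at hk
    rw [if_neg (by lia), if_neg (by lia)]

end DGA

namespace PoincareDGCA

variable {F : Type u} {A : Type v} [Field F] [Ring A] [Algebra F A] {n : ℤ}

theorem intg_mul_d (P : PoincareDGCA F A n) {i : ℤ} {a : A} (ha : a ∈ P.grading i)
    (hda : P.d a = 0) (b : A) : P.intg (a * P.d b) = 0 := by
  have h := P.intg_d (a * b)
  rw [P.leibniz a b ha, hda, zero_mul, zero_add, map_smul, smul_eq_mul] at h
  exact (mul_eq_zero.mp h).resolve_left (zpow_ne_zero _ (by simp))

theorem isExact_of_intg_eq_zero (P : PoincareDGCA F A n) (hconn : P.toDGA.Connected) {a : A}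
    (ha : a ∈ P.grading n) (hda : P.d a = 0) (h : P.intg a = 0) : P.toDGA.IsExact a := by
  refine P.nondeg n a ha hda fun b hb hdb => ?_
  rw [sub_self] at hb
  obtain ⟨c, rfl⟩ := hconn b hb hdb
  rw [mul_smul_comm, mul_one, map_smul, h, smul_zero]

/-- By duality, the cohomology of an `(r - 1)`-connected Poincaré DGCA of degree `n` vanishes in
degrees strictly above `n - r`, except in degree `n`. -/
theorem isExact_of_lt (P : PoincareDGCA F A n) {r : ℤ} (hconn : P.toDGA.RConnected (r - 1))
    {k : ℤ} (hk : n - r < k) (hkn : k ≠ n) {a : A} (ha : a ∈ P.grading k) (hda : P.d a = 0) :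
    P.toDGA.IsExact a := by
  rcases lt_or_gt_of_ne hkn with h | h
  · refine P.nondeg k a ha hda fun b hb hdb => ?_
    obtain ⟨c, rfl⟩ := hconn.2 (n - k) (by lia) (by lia) b hb hdb
    exact P.intg_mul_d ha hda c
  · rw [P.top k h, Submodule.mem_bot] at ha
    exact ⟨0, by rw [ha, map_zero]⟩

theorem masseyTrivial_of_lt (P : PoincareDGCA F A n) {r : ℤ}
    (hconn : P.toDGA.RConnected (r - 1)) {l : ℕ} (hl : 3 ≤ l) {deg : ℕ → ℤ} {x : ℕ → A}
    {a : ℕ → ℕ → A} (ha : P.toDGA.IsDefiningSystem l deg x a)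
    (hdeg : n - r < DGA.degSum deg 1 l + 1) : P.toDGA.MasseyTrivial l deg x := by
  have hmem := P.toDGA.masseyOut_mem ha
  have hd := P.toDGA.d_masseyOut ha
  by_cases hn : DGA.degSum deg 1 l + 1 = n
  swap
  · exact ⟨a, ha, P.isExact_of_lt hconn hdeg hn hmem hd⟩
  obtain ⟨hmem1, hd1, -⟩ := ha.1 1 le_rfl (by lia)
  by_cases hex : P.toDGA.IsExact (a 1 1)
  · exact P.toDGA.masseyTrivial_of_exact ha le_rfl (by lia) hex
  obtain ⟨b, hb, hdb, hne⟩ : ∃ b ∈ P.grading (n - deg 1), P.d b = 0 ∧ P.intg (a 1 1 * b) ≠ 0 := by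
    by_contra! h
    exact hex (P.nondeg _ _ hmem1 hd1 h)
  have h2 : n - deg 1 = DGA.degSum deg 2 l := by
    have := DGA.degSum_add deg (le_refl 1) (show 1 < l by lia)
    rw [DGA.degSum_self] at this
    lia
  rw [h2] at hb
  have hu : (-1 : F) ^ deg 1 ≠ 0 := zpow_ne_zero _ (by simp)
  obtain ⟨a', ha', hout⟩ := P.toDGA.exists_defining_add hl ha
    (z := (-((-1 : F) ^ deg 1)⁻¹ * (P.intg (a 1 1 * b))⁻¹ *
      P.intg (P.toDGA.masseyOut l deg a)) • b)
    (Submodule.smul_mem _ _ hb) (by rw [map_smul, hdb, smul_zero])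
  refine ⟨a', ha', P.isExact_of_intg_eq_zero hconn.1 (hn ▸ P.toDGA.masseyOut_mem ha')
    (P.toDGA.d_masseyOut ha') ?_⟩
  rw [hout, map_add, map_smul, mul_smul_comm, map_smul, smul_eq_mul, smul_eq_mul]
  field_simp
  ring

end PoincareDGCA

/-- Let `A*` be an `(r-1)`-connected (`r > 1`) Poincaré DGCA of degree
`n` and `l ≥ 3`.  (1) If `n ≤ r(l+1) + (1-l)`, the `l'`-th order Massey product of every
Massey `l'`-tuple is trivial for every `l' ≥ l`.  (2) If `n = r(l+1) + (2-l) + q` with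
`q ≥ 0`, then the `l`-th order Massey product of every Massey `l`-tuple whose degree
does not lie in `{(r+a₁, …, r+a_l) | aᵢ ≥ 0, ∑ aᵢ ≤ q}` is trivial. -/
theorem statement_18 {F : Type u} {A : Type v} [Field F] [Ring A] [Algebra F A] {n : ℤ}
    (P : PoincareDGCA F A n) (r : ℤ) (hr : 1 < r)
    (hconn : P.toDGA.RConnected (r - 1)) (l : ℕ) (hl : 3 ≤ l) :
    -- (1)
    (n ≤ r * ((l : ℤ) + 1) + (1 - (l : ℤ)) →
      ∀ l' : ℕ, l ≤ l' → ∀ (deg : ℕ → ℤ) (x : ℕ → A),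
        P.toDGA.IsMasseyTuple l' deg x → P.toDGA.MasseyTrivial l' deg x) ∧
    -- (2)
    (∀ q : ℤ, 0 ≤ q → n = r * ((l : ℤ) + 1) + (2 - (l : ℤ)) + q →
      ∀ (deg : ℕ → ℤ) (x : ℕ → A), P.toDGA.IsMasseyTuple l deg x →
        ¬((∀ i : ℕ, 1 ≤ i → i ≤ l → r ≤ deg i) ∧
          (∑ i ∈ Finset.Icc 1 l, (deg i - r)) ≤ q) →
        P.toDGA.MasseyTrivial l deg x) := by
  
  refine ⟨fun hn l' hl' deg x hx => ?_, fun q hq hn deg x hx hnot => ?_⟩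
  · obtain ⟨-, a, ha⟩ := hx
    by_cases h : ∀ i ∈ Finset.Icc 1 l', r ≤ deg i
    · refine P.masseyTrivial_of_lt hconn (hl.trans hl') ha ?_
      have hs := Finset.card_nsmul_le_sum _ deg r h
      rw [Nat.card_Icc, Nat.add_sub_cancel, nsmul_eq_mul] at hs
      have hc : (l : ℤ) ≤ l' := by exact_mod_cast hl'
      rw [DGA.degSum, Nat.cast_sub (by lia)]
      push_cast
      nlinarith [mul_nonneg (sub_nonneg.mpr hc) (sub_nonneg.mpr hr.le)]
    · push Not at h
      obtain ⟨i, hi, hlt⟩ := h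
      rw [Finset.mem_Icc] at hi
      exact P.toDGA.masseyTrivial_of_deg_lt hconn (hl.trans hl') ha hi.1 hi.2 hlt
  · obtain ⟨-, a, ha⟩ := hx
    by_cases h : ∀ i, 1 ≤ i → i ≤ l → r ≤ deg i
    · refine P.masseyTrivial_of_lt hconn hl ha ?_
      have hs : q < ∑ i ∈ Finset.Icc 1 l, (deg i - r) := not_le.mp fun h' => hnot ⟨h, h'⟩
      rw [Finset.sum_sub_distrib, Finset.sum_const, Nat.card_Icc, Nat.add_sub_cancel,
        nsmul_eq_mul] at hs
      rw [DGA.degSum, Nat.cast_sub (by lia)]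
      push_cast
      linarith
    · push Not at h
      obtain ⟨i, hi, hil, hlt⟩ := h
      exact P.toDGA.masseyTrivial_of_deg_lt hconn hl ha hi hil hlt
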